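/- Let d ≥ 2. There exists a linear operator R mapping every smooth 2π-periodic (in each coordinate) vector field v : ℝ^d → ℝ^d with ∫_{[0,2π]^d} v dx = 0 to a smooth 2π-periodic matrix field Rv : ℝ^d → ℝ^{d×d} such that: (i) Rv(x) is symmetric and trace-free for every x; (ii) div(Rv) = v, i.e. Σ_j ∂_{x_j} (Rv)_{ij} = v_i for every i; (iii) for every p ∈ [1,∞) there is a constant C_p (depending only on p and d) with ‖Rv‖_{L^p([0,2π]^d)} ≤ C_p ‖v‖_{L^p([0,2π]^d)} for all such v; and (iv) for every smooth 2π-periodic, mean-zero, divergence-free vector field v, R(Δv) = ∇v + (∇v)ᵀ. -/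

import Mathlib

open scoped BigOperators
open MeasureTheory Real

/-- Frobenius (Euclidean) norm of a `d × d` real matrix. -/
noncomputable def frobNorm {d : ℕ} (Q : Matrix (Fin d) (Fin d) ℝ) : ℝ :=
  Real.sqrt (∑ i, ∑ j, (Q i j) ^ 2)

/-- Fundamental domain `[0, 2π]^d` of the torus `T^d`. -/
def box (d : ℕ) : Set (Fin d → ℝ) := Set.Icc 0 (fun _ => 2 * π)

/-- A smooth, `2π`-periodic (in each coordinate), mean-zero vector field on `ℝ^d`. -/
def IsAdmissible {d : ℕ} (v : (Fin d → ℝ) → Fin d → ℝ) : Prop :=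
  ContDiff ℝ (⊤ : ℕ∞) v ∧
  (∀ (x : Fin d → ℝ) (k : Fin d), v (x + Pi.single k (2 * π)) = v x) ∧
  (∀ i, (∫ x in box d, v x i) = 0)

open scoped ContDiff Pointwise

/-- Periodicity with period `2π` in each coordinate. -/
def IsPeriodic {d : ℕ} {α : Type*} (f : (Fin d → ℝ) → α) : Prop :=
  ∀ (x : Fin d → ℝ) (k : Fin d), f (x + Pi.single k (2 * π)) = f x

/-- The basis `2π e₁, …, 2π e_d` generating the period lattice. -/
noncomputable def periodBasis (d : ℕ) : Module.Basis (Fin d) ℝ (Fin d → ℝ) :=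
  (Pi.basisFun ℝ (Fin d)).isUnitSMul (w := fun _ => 2 * π) fun _ => by simp [Real.pi_ne_zero]

lemma periodBasis_apply (d : ℕ) (i : Fin d) : periodBasis d i = Pi.single i (2 * π) := by
  rw [periodBasis, Module.Basis.isUnitSMul_apply, Pi.basisFun_apply, ← Pi.single_smul]
  simp

lemma IsPeriodic.add_mem {d : ℕ} {α : Type*} {f : (Fin d → ℝ) → α} (hf : IsPeriodic f)
    {v : Fin d → ℝ} (hv : v ∈ Submodule.span ℤ (Set.range (periodBasis d))) :
    ∀ x, f (x + v) = f x := by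
  induction hv using Submodule.span_induction with
  | mem v hv =>
    obtain ⟨i, rfl⟩ := hv
    intro x
    rw [periodBasis_apply, hf]
  | zero => simp
  | add v w _ _ hv hw => intro x; rw [← add_assoc, hw, hv]
  | smul n v _ hv =>
    have hneg : ∀ x, f (x - v) = f x := fun x => by rw [← hv (x - v), sub_add_cancel]
    induction n using Int.induction_on with
    | zero => simp
    | succ n ih => intro x; rw [add_smul, one_smul, ← add_assoc, hv, ih]
    | pred n ih => intro x; rw [sub_smul, one_smul, ← add_sub_assoc, hneg, ih]

lemma fundamentalDomain_periodBasis (d : ℕ) :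
    ZSpan.fundamentalDomain (periodBasis d) = Set.univ.pi fun _ => Set.Ico 0 (2 * π) := by
  have hpi : (0 : ℝ) < 2 * π := by positivity
  ext x
  have key : ∀ i, (periodBasis d).repr x i = (2 * π)⁻¹ * x i := fun i => by
    rw [periodBasis, Module.Basis.repr_isUnitSMul, Units.smul_def]
    simp
  simp only [ZSpan.mem_fundamentalDomain, key, Set.mem_univ_pi, Set.mem_Ico]
  refine forall_congr' fun i => ?_
  rw [inv_mul_lt_iff₀ hpi, mul_one, mul_nonneg_iff_of_pos_left (inv_pos.2 hpi)]

lemma fundamentalDomain_ae_eq_box (d : ℕ) :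
    ZSpan.fundamentalDomain (periodBasis d) =ᵐ[volume] box d := by
  rw [fundamentalDomain_periodBasis, box]
  exact Measure.univ_pi_Ico_ae_eq_Icc

instance (d : ℕ) : Countable (Submodule.span ℤ (Set.range (periodBasis d))).toAddSubgroup :=
  inferInstanceAs (Countable (Submodule.span ℤ (Set.range (periodBasis d))))

lemma isAddFundamentalDomain_vadd (d : ℕ) (y : Fin d → ℝ) :
    IsAddFundamentalDomain (Submodule.span ℤ (Set.range (periodBasis d))).toAddSubgroup
      (y +ᵥ ZSpan.fundamentalDomain (periodBasis d)) volume :=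
  (ZSpan.isAddFundamentalDomain' (periodBasis d) volume).vadd_of_comm y

lemma IsPeriodic.setLIntegral_add {d : ℕ} {f : (Fin d → ℝ) → ENNReal} (hf : IsPeriodic f)
    (y : Fin d → ℝ) : ∫⁻ x in box d, f (x + y) = ∫⁻ x in box d, f x := by
  have hae := fundamentalDomain_ae_eq_box d
  rw [← setLIntegral_congr hae, ← setLIntegral_congr hae]
  have h1 := (measurePreserving_vadd y (volume : Measure (Fin d → ℝ))).setLIntegral_comp_emb
    (measurableEmbedding_const_vadd y) f (ZSpan.fundamentalDomain (periodBasis d))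
  simp_rw [add_comm _ y]
  refine h1.trans ?_
  refine IsAddFundamentalDomain.setLIntegral_eq (isAddFundamentalDomain_vadd d y)
    (ZSpan.isAddFundamentalDomain' (periodBasis d) volume) f fun g x => ?_
  rw [AddSubgroup.vadd_def, vadd_eq_add, add_comm]
  exact hf.add_mem g.2 x

lemma IsPeriodic.setIntegral_add {d : ℕ} {f : (Fin d → ℝ) → ℝ} (hf : IsPeriodic f)
    (y : Fin d → ℝ) : ∫ x in box d, f (x + y) = ∫ x in box d, f x := by
  have hae := fundamentalDomain_ae_eq_box d
  rw [← setIntegral_congr_set hae, ← setIntegral_congr_set hae]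
  have h1 := (measurePreserving_vadd y (volume : Measure (Fin d → ℝ))).setIntegral_image_emb
    (measurableEmbedding_const_vadd y) f (ZSpan.fundamentalDomain (periodBasis d))
  simp_rw [add_comm _ y]
  refine h1.symm.trans ?_
  refine IsAddFundamentalDomain.setIntegral_eq (isAddFundamentalDomain_vadd d y)
    (ZSpan.isAddFundamentalDomain' (periodBasis d) volume) fun g x => ?_
  rw [AddSubgroup.vadd_def, vadd_eq_add, add_comm]
  exact hf.add_mem g.2 x

lemma IsPeriodic.exists_bound {d : ℕ} {F : Type*} [NormedAddCommGroup F] {f : (Fin d → ℝ) → F}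
    (hf : IsPeriodic f) (hc : Continuous f) : ∃ C, ∀ x, ‖f x‖ ≤ C := by
  obtain ⟨C, hC⟩ := (isCompact_Icc (a := (0 : Fin d → ℝ))
    (b := fun _ => 2 * π)).exists_bound_of_continuousOn hc.continuousOn
  refine ⟨C, fun x => ?_⟩
  have h1 : f x = f (ZSpan.fract (periodBasis d) x) := by
    rw [← hf.add_mem (ZSpan.floor (periodBasis d) x).2 (ZSpan.fract _ x), ZSpan.fract,
      sub_add_cancel]
  have h2 := ZSpan.fract_mem_fundamentalDomain (periodBasis d) x
  rw [fundamentalDomain_periodBasis, Set.mem_univ_pi] at h2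
  rw [h1]
  exact hC _ ⟨fun i => (h2 i).1, fun i => (h2 i).2.le⟩

/-- Smooth functions that are `2π`-periodic in each coordinate. -/
def SmoothPeriodic {d : ℕ} {F : Type*} [NormedAddCommGroup F] [NormedSpace ℝ F]
    (f : (Fin d → ℝ) → F) : Prop :=
  ContDiff ℝ ∞ f ∧ IsPeriodic f

/-- The partial derivative `∂ᵢ`. -/
noncomputable def partialDeriv {d : ℕ} (i : Fin d) (f : (Fin d → ℝ) → ℝ) (x : Fin d → ℝ) : ℝ :=
  fderiv ℝ f x (Pi.single i 1)

/-- The Laplacian. -/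
noncomputable def lap {d : ℕ} (f : (Fin d → ℝ) → ℝ) (x : Fin d → ℝ) : ℝ :=
  ∑ l, partialDeriv l (partialDeriv l f) x

namespace SmoothPeriodic

variable {d : ℕ} {F : Type*} [NormedAddCommGroup F] [NormedSpace ℝ F]

lemma continuous {f : (Fin d → ℝ) → F} (hf : SmoothPeriodic f) : Continuous f := hf.1.continuous

lemma differentiable {f : (Fin d → ℝ) → F} (hf : SmoothPeriodic f) : Differentiable ℝ f :=
  hf.1.differentiable (by simp)

lemma exists_bound {f : (Fin d → ℝ) → F} (hf : SmoothPeriodic f) : ∃ C, ∀ x, ‖f x‖ ≤ C :=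
  hf.2.exists_bound hf.continuous

lemma fderiv {f : (Fin d → ℝ) → F} (hf : SmoothPeriodic f) : SmoothPeriodic (fderiv ℝ f) := by
  refine ⟨hf.1.fderiv_right (by simp), fun x k => ?_⟩
  rw [← fderiv_comp_add_right]
  congr 1
  exact funext fun y => hf.2 y k

lemma add {f g : (Fin d → ℝ) → F} (hf : SmoothPeriodic f) (hg : SmoothPeriodic g) :
    SmoothPeriodic (fun x => f x + g x) :=
  ⟨hf.1.add hg.1, fun x k => by simp only [hf.2 x k, hg.2 x k]⟩

lemma const_smul {f : (Fin d → ℝ) → F} (hf : SmoothPeriodic f) (c : ℝ) :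
    SmoothPeriodic (fun x => c • f x) :=
  ⟨hf.1.const_smul c, fun x k => by simp only [hf.2 x k]⟩

lemma const_mul {f : (Fin d → ℝ) → ℝ} (hf : SmoothPeriodic f) (c : ℝ) :
    SmoothPeriodic (fun x => c * f x) :=
  hf.const_smul c

lemma const (c : F) : SmoothPeriodic (fun _ : Fin d → ℝ => c) :=
  ⟨contDiff_const, fun _ _ => rfl⟩

lemma sum {ι : Type*} (s : Finset ι) {f : ι → (Fin d → ℝ) → F}
    (hf : ∀ i ∈ s, SmoothPeriodic (f i)) : SmoothPeriodic (fun x => ∑ i ∈ s, f i x) :=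
  ⟨ContDiff.sum fun i hi => (hf i hi).1,
    fun x k => Finset.sum_congr rfl fun i hi => (hf i hi).2 x k⟩

lemma partialDeriv {f : (Fin d → ℝ) → ℝ} (hf : SmoothPeriodic f) (i : Fin d) :
    SmoothPeriodic (partialDeriv i f) :=
  ⟨hf.fderiv.1.clm_apply contDiff_const, fun x k => by
    simp only [_root_.partialDeriv, hf.fderiv.2 x k]⟩

lemma lap {f : (Fin d → ℝ) → ℝ} (hf : SmoothPeriodic f) : SmoothPeriodic (lap f) :=
  sum _ fun i _ => (hf.partialDeriv i).partialDeriv i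

end SmoothPeriodic

section PartialDeriv

variable {d : ℕ}

lemma partialDeriv_comm {f : (Fin d → ℝ) → ℝ} (hf : SmoothPeriodic f) (i j : Fin d) :
    partialDeriv i (partialDeriv j f) = partialDeriv j (partialDeriv i f) := by
  have key : ∀ (i j : Fin d) x, partialDeriv i (partialDeriv j f) x =
      fderiv ℝ (fderiv ℝ f) x (Pi.single i 1) (Pi.single j 1) := fun i j x => by
    have h : HasFDerivAt (fderiv ℝ f) (fderiv ℝ (fderiv ℝ f) x) x :=
      (hf.fderiv.differentiable x).hasFDerivAt
    have h2 := h.clm_apply (hasFDerivAt_const (Pi.single j (1 : ℝ)) x)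
    change fderiv ℝ (fun y => fderiv ℝ f y (Pi.single j 1)) x (Pi.single i 1) = _
    rw [h2.fderiv]
    simp
  funext x
  rw [key, key]
  exact (hf.1.contDiffAt.isSymmSndFDerivAt
    (by rw [minSmoothness_of_isRCLikeNormedField]; exact WithTop.coe_le_coe.2 le_top)) _ _

lemma partialDeriv_sum {ι : Type*} (s : Finset ι) {f : ι → (Fin d → ℝ) → ℝ}
    (hf : ∀ i ∈ s, SmoothPeriodic (f i)) (j : Fin d) :
    partialDeriv j (fun x => ∑ i ∈ s, f i x) = fun x => ∑ i ∈ s, partialDeriv j (f i) x := by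
  funext x
  rw [partialDeriv, fderiv_fun_sum fun i hi => (hf i hi).differentiable x]
  simp [partialDeriv]

lemma partialDeriv_add {f g : (Fin d → ℝ) → ℝ} (hf : SmoothPeriodic f) (hg : SmoothPeriodic g)
    (j : Fin d) :
    partialDeriv j (fun x => f x + g x) = fun x => partialDeriv j f x + partialDeriv j g x := by
  funext x
  rw [partialDeriv, fderiv_fun_add (hf.differentiable x) (hg.differentiable x)]
  rfl

lemma partialDeriv_const_mul {f : (Fin d → ℝ) → ℝ} (hf : SmoothPeriodic f) (c : ℝ) (j : Fin d) :
    partialDeriv j (fun x => c * f x) = fun x => c * partialDeriv j f x := by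
  funext x
  rw [partialDeriv, fderiv_const_mul (hf.differentiable x)]
  rfl

lemma partialDeriv_sub_const (f : (Fin d → ℝ) → ℝ) (c : ℝ) (j : Fin d) :
    partialDeriv j (fun x => f x - c) = partialDeriv j f := by
  funext x
  rw [partialDeriv, fderiv_sub_const]
  rfl

lemma partialDeriv_const (c : ℝ) (j : Fin d) :
    partialDeriv j (fun _ : Fin d → ℝ => c) = fun _ => 0 := by
  funext x
  simp [partialDeriv]

lemma lap_partialDeriv {f : (Fin d → ℝ) → ℝ} (hf : SmoothPeriodic f) (j : Fin d) :
    lap (partialDeriv j f) = partialDeriv j (lap f) := by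
  have : partialDeriv j (lap f) = fun x => ∑ l, partialDeriv j (partialDeriv l (partialDeriv l f)) x :=
    partialDeriv_sum _ (fun i _ => (hf.partialDeriv i).partialDeriv i) j
  rw [this]
  funext x
  refine Finset.sum_congr rfl fun l _ => ?_
  rw [partialDeriv_comm hf l j, partialDeriv_comm (hf.partialDeriv l) l j]

lemma fderiv_apply_eq_sum {f : (Fin d → ℝ) → ℝ} (x v : Fin d → ℝ) :
    fderiv ℝ f x v = ∑ i, v i * partialDeriv i f x := by
  conv_lhs => rw [pi_eq_sum_univ' v]
  simp [map_sum, partialDeriv]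

end PartialDeriv

/-- The average `x ↦ ∫ f (x + y) dμ(y)` of the translates of `f`. -/
noncomputable def avg {d : ℕ} {F : Type*} [NormedAddCommGroup F] [NormedSpace ℝ F]
    (μ : Measure (Fin d → ℝ)) (f : (Fin d → ℝ) → F) (x : Fin d → ℝ) : F :=
  ∫ y, f (x + y) ∂μ

section Avg

variable {d : ℕ} {F : Type*} [NormedAddCommGroup F] [NormedSpace ℝ F]
  {μ : Measure (Fin d → ℝ)} [IsFiniteMeasure μ]

lemma SmoothPeriodic.integrable_comp {X : Type*} [MeasurableSpace X] {ρ : Measure X}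
    [IsFiniteMeasure ρ] {f : (Fin d → ℝ) → F} (hf : SmoothPeriodic f)
    {y : X → Fin d → ℝ} (hy : Measurable y) : Integrable (fun a => f (y a)) ρ := by
  obtain ⟨C, hC⟩ := hf.exists_bound
  exact Integrable.of_bound (hf.continuous.stronglyMeasurable.comp_measurable hy).aestronglyMeasurable
    C (ae_of_all _ fun y => hC _)

lemma SmoothPeriodic.integrable_add {f : (Fin d → ℝ) → F} (hf : SmoothPeriodic f)
    (x : Fin d → ℝ) : Integrable (fun y => f (x + y)) μ :=
  hf.integrable_comp (measurable_const_add x)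

lemma hasFDerivAt_avg {f : (Fin d → ℝ) → F} (hf : SmoothPeriodic f) (x : Fin d → ℝ) :
    HasFDerivAt (avg μ f) (avg μ (fderiv ℝ f) x) x := by
  obtain ⟨C, hC⟩ := hf.fderiv.exists_bound
  refine hasFDerivAt_integral_of_dominated_of_fderiv_le (bound := fun _ => C)
    (F' := fun z y => fderiv ℝ f (z + y)) Filter.univ_mem
    (Filter.Eventually.of_forall fun z => (hf.integrable_add z).aestronglyMeasurable)
    (hf.integrable_add x) (hf.fderiv.integrable_add x).aestronglyMeasurable
    (ae_of_all _ fun y z _ => hC _) (integrable_const _) (ae_of_all _ fun y z _ => ?_)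
  exact (hasFDerivAt_comp_add_right y).2 (hf.differentiable (z + y)).hasFDerivAt

lemma contDiff_avg (n : ℕ) : ∀ {F : Type} [NormedAddCommGroup F] [NormedSpace ℝ F]
    {f : (Fin d → ℝ) → F}, SmoothPeriodic f → ContDiff ℝ n (avg μ f) := by
  induction n with
  | zero =>
    intro F _ _ f hf
    exact contDiff_zero.2
      (continuous_iff_continuousAt.2 fun x => (hasFDerivAt_avg hf x).continuousAt)
  | succ n ih =>
    intro F _ _ f hf
    exact contDiff_succ_iff_hasFDerivAt.2 ⟨_, ih hf.fderiv, hasFDerivAt_avg hf⟩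

lemma SmoothPeriodic.avg {f : (Fin d → ℝ) → ℝ} (hf : SmoothPeriodic f) :
    SmoothPeriodic (avg μ f) :=
  ⟨contDiff_infty.2 fun n => contDiff_avg n hf, fun x k => by
    simp only [_root_.avg, add_right_comm x, hf.2 _ k]⟩

lemma partialDeriv_avg {f : (Fin d → ℝ) → ℝ} (hf : SmoothPeriodic f) (i : Fin d) :
    partialDeriv i (avg μ f) = avg μ (partialDeriv i f) := by
  funext x
  rw [partialDeriv, (hasFDerivAt_avg hf x).fderiv, avg,
    ContinuousLinearMap.integral_apply (hf.fderiv.integrable_add x)]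
  rfl

lemma avg_add {f g : (Fin d → ℝ) → ℝ} (hf : SmoothPeriodic f) (hg : SmoothPeriodic g) :
    avg μ (fun x => f x + g x) = fun x => avg μ f x + avg μ g x :=
  funext fun x => integral_add (hf.integrable_add x) (hg.integrable_add x)

omit [IsFiniteMeasure μ] in
lemma avg_const_mul (f : (Fin d → ℝ) → ℝ) (c : ℝ) :
    avg μ (fun x => c * f x) = fun x => c * avg μ f x :=
  funext fun _ => integral_const_mul _ _

lemma avg_sum {ι : Type*} (s : Finset ι) {f : ι → (Fin d → ℝ) → ℝ}
    (hf : ∀ i ∈ s, SmoothPeriodic (f i)) :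
    avg μ (fun x => ∑ i ∈ s, f i x) = fun x => ∑ i ∈ s, avg μ (f i) x :=
  funext fun x => integral_finsetSum s fun i hi => (hf i hi).integrable_add x

lemma lap_avg {f : (Fin d → ℝ) → ℝ} (hf : SmoothPeriodic f) :
    lap (avg μ f) = avg μ (lap f) := by
  have : avg μ (lap f) = fun x => ∑ l, avg μ (partialDeriv l (partialDeriv l f)) x :=
    avg_sum _ fun i _ => (hf.partialDeriv i).partialDeriv i
  rw [this]
  funext x
  simp only [lap, partialDeriv_avg hf, partialDeriv_avg (hf.partialDeriv _)]

end Avg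

section Geometric

variable {d : ℕ}

/-- Iterated convolution powers of a measure. -/
noncomputable def convPow (q : Measure (Fin d → ℝ)) : ℕ → Measure (Fin d → ℝ)
  | 0 => Measure.dirac 0
  | n + 1 => Measure.conv (convPow q n) q

instance (q : Measure (Fin d → ℝ)) [IsFiniteMeasure q] (n : ℕ) :
    IsFiniteMeasure (convPow q n) := by
  induction n with
  | zero => rw [convPow]; infer_instance
  | succ n ih => rw [convPow]; infer_instance

lemma convPow_univ (q : Measure (Fin d → ℝ)) [IsFiniteMeasure q] (n : ℕ) :
    convPow q n Set.univ = q Set.univ ^ n := by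
  induction n with
  | zero => simp [convPow]
  | succ n ih =>
    rw [convPow, Measure.conv, Measure.map_apply (by fun_prop) MeasurableSet.univ,
      Set.preimage_univ, ← Set.univ_prod_univ, Measure.prod_prod, ih, pow_succ]

lemma avg_convPow_succ (q : Measure (Fin d → ℝ)) [IsFiniteMeasure q] (n : ℕ)
    {f : (Fin d → ℝ) → ℝ} (hf : SmoothPeriodic f) (x : Fin d → ℝ) :
    avg (convPow q (n + 1)) f x = avg (convPow q n) (avg q f) x := by
  have hm : Measurable fun p : (Fin d → ℝ) × (Fin d → ℝ) => p.1 + p.2 := by fun_prop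
  rw [avg, convPow, Measure.conv, integral_map hm.aemeasurable
    (hf.integrable_add x).aestronglyMeasurable,
    integral_prod _ (hf.integrable_comp (y := fun p : (Fin d → ℝ) × (Fin d → ℝ) => x + (p.1 + p.2))
      (by fun_prop))]
  simp only [avg, add_assoc]

lemma exists_geometric_measure (q : Measure (Fin d → ℝ)) [IsFiniteMeasure q]
    (hq : q Set.univ < 1) :
    ∃ ρ : Measure (Fin d → ℝ), IsFiniteMeasure ρ ∧ ∀ f : (Fin d → ℝ) → ℝ, SmoothPeriodic f →
      ∀ x, avg ρ f x = f x + avg ρ (avg q f) x := by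
  have hfin : IsFiniteMeasure (Measure.sum (convPow q)) := ⟨by
    rw [Measure.sum_apply _ MeasurableSet.univ]
    simp only [convPow_univ, ENNReal.tsum_geometric]
    exact ENNReal.inv_lt_top.2 (tsub_pos_of_lt hq)⟩
  refine ⟨Measure.sum (convPow q), hfin, fun f hf x => ?_⟩
  have h1 := hasSum_integral_measure (hf.integrable_add (μ := Measure.sum (convPow q)) x)
  have h2 := hasSum_integral_measure
    ((hf.avg (μ := q)).integrable_add (μ := Measure.sum (convPow q)) x)
  have h3 := (hasSum_nat_add_iff' (f := fun n => ∫ y, f (x + y) ∂convPow q n) 1).2 h1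
  simp only [Finset.range_one, Finset.sum_singleton] at h3
  have h4 : (fun n => ∫ y, f (x + y) ∂convPow q (n + 1)) =
      fun n => ∫ y, avg q f (x + y) ∂convPow q n := funext fun n => avg_convPow_succ q n hf x
  rw [h4] at h3
  have h5 := h3.unique h2
  have h6 : ∫ y, f (x + y) ∂convPow q 0 = f x := by
    rw [convPow, integral_dirac, add_zero]
  rw [h6] at h5
  simp only [avg] at h5 ⊢
  linarith

end Geometric

section Lp

variable {d : ℕ}

lemma eLpNorm_le_of_enorm_le_lintegral {X : Type*} [MeasurableSpace X] (μ : Measure X)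
    [IsFiniteMeasure μ] {y : X → Fin d → ℝ} (hy : Measurable y) {f g : (Fin d → ℝ) → ℝ}
    (hf : SmoothPeriodic f) (hg : ∀ x, ‖g x‖ₑ ≤ ∫⁻ a, ‖f (x + y a)‖ₑ ∂μ) {p : ℝ} (hp : 1 ≤ p) :
    eLpNorm g (ENNReal.ofReal p) (volume.restrict (box d)) ≤
      μ Set.univ * eLpNorm f (ENNReal.ofReal p) (volume.restrict (box d)) := by
  have hp0 : 0 < p := by linarith
  have hp1 : ENNReal.ofReal p ≠ 0 := by simpa using hp0
  have htr : (ENNReal.ofReal p).toReal = p := ENNReal.toReal_ofReal hp0.le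
  rw [eLpNorm_eq_lintegral_rpow_enorm_toReal hp1 ENNReal.ofReal_ne_top,
    eLpNorm_eq_lintegral_rpow_enorm_toReal hp1 ENNReal.ofReal_ne_top, htr]
  have hmeas : Measurable fun z : (Fin d → ℝ) × X => ‖f (z.1 + y z.2)‖ₑ ^ p :=
    ((hf.continuous.measurable.comp
      (measurable_fst.add (hy.comp measurable_snd))).enorm).pow_const p
  have hpt : ∀ x, ‖g x‖ₑ ^ p ≤ μ Set.univ ^ (p - 1) * ∫⁻ a, ‖f (x + y a)‖ₑ ^ p ∂μ := fun x => by
    have hm : AEStronglyMeasurable (fun a => f (x + y a)) μ :=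
      (hf.integrable_comp (measurable_const_add x |>.comp hy)).aestronglyMeasurable
    have h := eLpNorm_le_eLpNorm_mul_rpow_measure_univ (p := 1) (q := ENNReal.ofReal p)
      (by simpa using hp) hm
    rw [eLpNorm_one_eq_lintegral_enorm,
      eLpNorm_eq_lintegral_rpow_enorm_toReal hp1 ENNReal.ofReal_ne_top, htr,
      ENNReal.toReal_one] at h
    calc ‖g x‖ₑ ^ p ≤ _ := ENNReal.rpow_le_rpow ((hg x).trans h) hp0.le
      _ = _ := by
        rw [ENNReal.mul_rpow_of_nonneg _ _ hp0.le, ← ENNReal.rpow_mul, ← ENNReal.rpow_mul,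
          one_div_mul_cancel hp0.ne', ENNReal.rpow_one, mul_comm]
        congr 2
        field_simp
  have hint : ∫⁻ x in box d, ‖g x‖ₑ ^ p ≤
      μ Set.univ ^ p * ∫⁻ x in box d, ‖f x‖ₑ ^ p := by
    calc ∫⁻ x in box d, ‖g x‖ₑ ^ p
        ≤ ∫⁻ x in box d, μ Set.univ ^ (p - 1) * ∫⁻ a, ‖f (x + y a)‖ₑ ^ p ∂μ :=
          lintegral_mono hpt
      _ = μ Set.univ ^ (p - 1) * ∫⁻ a, (∫⁻ x in box d, ‖f (x + y a)‖ₑ ^ p) ∂μ := by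
          rw [lintegral_const_mul _ hmeas.lintegral_prod_right',
            lintegral_lintegral_swap hmeas.aemeasurable]
      _ = μ Set.univ ^ (p - 1) * (μ Set.univ * ∫⁻ x in box d, ‖f x‖ₑ ^ p) := by
          have hper : IsPeriodic fun x => ‖f x‖ₑ ^ p := fun x k => by simp only [hf.2 x k]
          simp_rw [hper.setLIntegral_add, lintegral_const]
          rw [mul_comm (μ Set.univ)]
      _ = _ := by
          rw [← mul_assoc]
          congr 1
          nth_rewrite 2 [← ENNReal.rpow_one (μ Set.univ)]
          rw [← ENNReal.rpow_add_of_nonneg _ _ (by linarith) zero_le_one, sub_add_cancel]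
  calc (∫⁻ x in box d, ‖g x‖ₑ ^ p) ^ (1 / p)
      ≤ (μ Set.univ ^ p * ∫⁻ x in box d, ‖f x‖ₑ ^ p) ^ (1 / p) :=
        ENNReal.rpow_le_rpow hint (by positivity)
    _ = _ := by
        rw [ENNReal.mul_rpow_of_nonneg _ _ (by positivity), ← ENNReal.rpow_mul,
          mul_one_div_cancel hp0.ne', ENNReal.rpow_one]

lemma eLpNorm_avg_le (μ : Measure (Fin d → ℝ)) [IsFiniteMeasure μ] {f : (Fin d → ℝ) → ℝ}
    (hf : SmoothPeriodic f) {p : ℝ} (hp : 1 ≤ p) :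
    eLpNorm (avg μ f) (ENNReal.ofReal p) (volume.restrict (box d)) ≤
      μ Set.univ * eLpNorm f (ENNReal.ofReal p) (volume.restrict (box d)) :=
  eLpNorm_le_of_enorm_le_lintegral μ measurable_id hf
    (fun _ => enorm_integral_le_lintegral_enorm _) hp

end Lp

section Gaussian

variable {d : ℕ}

/-- The standard Gaussian density on `ℝ^d`. -/
noncomputable def gauss (z : Fin d → ℝ) : ℝ := ∏ i, ProbabilityTheory.gaussianPDFReal 0 1 (z i)

lemma gauss_eq (z : Fin d → ℝ) :
    gauss z = (∏ _i : Fin d, (√(2 * π * 1))⁻¹) * exp (-(∑ i, z i ^ 2) / 2) := by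
  simp only [gauss, ProbabilityTheory.gaussianPDFReal, Finset.prod_mul_distrib, ← exp_sum]
  congr 2
  rw [← Finset.sum_neg_distrib, Finset.sum_div]
  simp

lemma gauss_pos (z : Fin d → ℝ) : 0 < gauss z :=
  Finset.prod_pos fun _ _ => ProbabilityTheory.gaussianPDFReal_pos _ _ _ one_ne_zero

lemma continuous_gauss : Continuous (gauss : (Fin d → ℝ) → ℝ) := by
  have : (gauss : (Fin d → ℝ) → ℝ) =
      fun z => (∏ _i : Fin d, (√(2 * π * 1))⁻¹) * exp (-(∑ i, z i ^ 2) / 2) := funext gauss_eq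
  rw [this]
  fun_prop

lemma integral_gauss : ∫ z : Fin d → ℝ, gauss z = 1 := by
  have := integral_fintype_prod_eq_prod (𝕜 := ℝ) (ι := Fin d) (E := fun _ => ℝ)
    (fun _ => ProbabilityTheory.gaussianPDFReal 0 1) (μ := fun _ => volume)
  simp only [ProbabilityTheory.integral_gaussianPDFReal_eq_one 0 one_ne_zero,
    Finset.prod_const_one] at this
  exact this

lemma hasLineDerivAt_gauss (z : Fin d → ℝ) (i : Fin d) :
    HasLineDerivAt ℝ gauss (-z i * gauss z) z (Pi.single i 1) := by
  have h1 : ∀ j, HasDerivAt (fun t : ℝ => (z + t • (Pi.single i 1 : Fin d → ℝ)) j ^ 2)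
      (2 * z j * (Pi.single i 1 : Fin d → ℝ) j) 0 := fun j => by
    have := (((hasDerivAt_id (0 : ℝ)).mul_const ((Pi.single i 1 : Fin d → ℝ) j)).const_add
      (z j)).fun_pow 2
    simpa using this
  have h2 := ((HasDerivAt.fun_sum fun j (_ : j ∈ Finset.univ) => h1 j).fun_neg.div_const 2).exp.const_mul
    (∏ _i : Fin d, (√(2 * π * 1))⁻¹)
  have h3 : ∑ j, 2 * z j * (Pi.single i 1 : Fin d → ℝ) j = 2 * z i := by
    rw [Finset.sum_eq_single i] <;> simp +contextual
  rw [h3] at h2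
  unfold HasLineDerivAt
  simp only [gauss_eq]
  refine h2.congr_deriv ?_
  simp only [zero_smul, add_zero]
  ring

/-- A polynomial multiple of the Gaussian density. -/
noncomputable def gaussKernel (P : MvPolynomial (Fin d) ℝ) (z : Fin d → ℝ) : ℝ :=
  MvPolynomial.eval z P * gauss z

lemma continuous_gaussKernel (P : MvPolynomial (Fin d) ℝ) : Continuous (gaussKernel P) :=
  (MvPolynomial.continuous_eval P).mul continuous_gauss

lemma integrable_pow_mul_gaussianPDFReal (n : ℕ) :
    Integrable fun x : ℝ => x ^ n * ProbabilityTheory.gaussianPDFReal 0 1 x := by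
  have h := (integrable_rpow_mul_exp_neg_mul_sq (b := 1 / 2) (by norm_num) (s := n)
    (by linarith [n.cast_nonneg (α := ℝ)])).const_mul (√(2 * π * 1))⁻¹
  refine h.congr (ae_of_all _ fun x => ?_)
  simp only [ProbabilityTheory.gaussianPDFReal, rpow_natCast, NNReal.coe_one]
  ring_nf

lemma integrable_gaussKernel (P : MvPolynomial (Fin d) ℝ) : Integrable (gaussKernel P) := by
  have : gaussKernel P = fun z => ∑ e ∈ P.support, P.coeff e *
      ∏ i, (z i ^ e i * ProbabilityTheory.gaussianPDFReal 0 1 (z i)) := by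
    funext z
    simp only [gaussKernel, MvPolynomial.eval_eq', gauss, Finset.sum_mul,
      Finset.prod_mul_distrib, mul_assoc]
  rw [this]
  refine integrable_finsetSum _ fun e _ => Integrable.const_mul ?_ _
  exact Integrable.fintype_prod (f := fun i (x : ℝ) => x ^ e i *
    ProbabilityTheory.gaussianPDFReal 0 1 x) fun i => integrable_pow_mul_gaussianPDFReal (e i)

lemma hasLineDerivAt_eval (P : MvPolynomial (Fin d) ℝ) (z : Fin d → ℝ) (i : Fin d) :
    HasLineDerivAt ℝ (fun z => MvPolynomial.eval z P)
      (MvPolynomial.eval z (MvPolynomial.pderiv i P)) z (Pi.single i 1) := by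
  unfold HasLineDerivAt
  induction P using MvPolynomial.induction_on with
  | C a => simpa using hasDerivAt_const (0 : ℝ) a
  | add p q hp hq => simpa using hp.fun_add hq
  | mul_X p n hp =>
    have h1 : HasDerivAt (fun t : ℝ => (z + t • (Pi.single i 1 : Fin d → ℝ)) n)
        ((Pi.single i 1 : Fin d → ℝ) n) 0 := by
      simpa using ((hasDerivAt_id (0 : ℝ)).mul_const ((Pi.single i 1 : Fin d → ℝ) n)).const_add
        (z n)
    have h2 := hp.mul h1
    simp only [map_mul, MvPolynomial.eval_X, Derivation.leibniz, MvPolynomial.pderiv_X, map_add,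
      smul_eq_mul]
    refine h2.congr_deriv ?_
    rcases eq_or_ne n i with rfl | h
    · simp; ring
    · simp [h]; ring

lemma hasLineDerivAt_gaussKernel (P : MvPolynomial (Fin d) ℝ) (z : Fin d → ℝ) (i : Fin d) :
    HasLineDerivAt ℝ (gaussKernel P)
      (gaussKernel (MvPolynomial.pderiv i P - MvPolynomial.X i * P) z) z (Pi.single i 1) := by
  have h := HasDerivAt.mul (hasLineDerivAt_eval P z i) (hasLineDerivAt_gauss z i)
  refine h.congr_deriv ?_
  simp only [gaussKernel, map_sub, map_mul, MvPolynomial.eval_X, zero_smul, add_zero]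
  ring

/-- Averages of dilated translates of `f` against a polynomial multiple of the Gaussian. -/
noncomputable def gaussAvg (P : MvPolynomial (Fin d) ℝ) (s : ℝ) (f : (Fin d → ℝ) → ℝ)
    (x : Fin d → ℝ) : ℝ :=
  ∫ z, gaussKernel P z * f (x + s • z)

lemma integrable_gaussKernel_mul (P : MvPolynomial (Fin d) ℝ) {f : (Fin d → ℝ) → ℝ}
    (hf : SmoothPeriodic f) (x : Fin d → ℝ) (s : ℝ) :
    Integrable fun z => gaussKernel P z * f (x + s • z) := by
  obtain ⟨C, hC⟩ := hf.exists_bound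
  have hc := hf.continuous
  exact (integrable_gaussKernel P).mul_bdd (Continuous.aestronglyMeasurable (by fun_prop))
    (ae_of_all _ fun z => hC _)

lemma mul_gaussAvg_partialDeriv (P : MvPolynomial (Fin d) ℝ) {f : (Fin d → ℝ) → ℝ}
    (hf : SmoothPeriodic f) (x : Fin d → ℝ) (s : ℝ) (i : Fin d) :
    s * gaussAvg P s (partialDeriv i f) x =
      gaussAvg (MvPolynomial.X i * P - MvPolynomial.pderiv i P) s f x := by
  have hsub : ∀ z, gaussKernel (MvPolynomial.X i * P - MvPolynomial.pderiv i P) z =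
      -gaussKernel (MvPolynomial.pderiv i P - MvPolynomial.X i * P) z := fun z => by
    simp only [gaussKernel, map_sub]; ring
  have hd : ∀ z, HasLineDerivAt ℝ (fun z => f (x + s • z)) (s * partialDeriv i f (x + s • z)) z
      (Pi.single i 1) := fun z => by
    have h1 : HasDerivAt (fun t : ℝ => x + s • (z + t • (Pi.single i 1 : Fin d → ℝ)))
        (s • Pi.single i 1) 0 := by
      have := ((((hasDerivAt_id (0 : ℝ)).smul_const (Pi.single i 1 : Fin d → ℝ)).const_add
        z).const_smul s).const_add x
      simpa using this
    have h2 : HasFDerivAt f (fderiv ℝ f (x + s • z))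
        (x + s • (z + (0 : ℝ) • (Pi.single i 1 : Fin d → ℝ))) := by
      simpa using (hf.differentiable (x + s • z)).hasFDerivAt
    refine (h2.comp_hasDerivAt 0 h1).congr_deriv ?_
    rw [map_smul]; rfl
  have key := integral_bilinear_hasLineDerivAt_right_eq_neg_left_of_integrable
    (μ := (volume : Measure (Fin d → ℝ))) (B := ContinuousLinearMap.mul ℝ ℝ)
    (f := gaussKernel P) (f' := gaussKernel (MvPolynomial.pderiv i P - MvPolynomial.X i * P))
    (g := fun z => f (x + s • z)) (g' := fun z => s * partialDeriv i f (x + s • z))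
    (v := Pi.single i 1) (integrable_gaussKernel_mul _ hf x s)
    (by
      refine ((integrable_gaussKernel_mul P (hf.partialDeriv i) x s).const_mul s).congr
        (ae_of_all _ fun z => ?_)
      simp only [ContinuousLinearMap.mul_apply']; ring)
    (integrable_gaussKernel_mul _ hf x s)
    (fun z _ => hasLineDerivAt_gaussKernel P z i) (fun z _ => hd z)
  simp only [ContinuousLinearMap.mul_apply'] at key
  simp only [gaussAvg, hsub, neg_mul, integral_neg, ← integral_const_mul]
  rw [← key]
  exact integral_congr_ae (ae_of_all _ fun z => by ring)

lemma hasDerivAt_gaussAvg {f : (Fin d → ℝ) → ℝ} (hf : SmoothPeriodic f) (x : Fin d → ℝ) (s : ℝ) :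
    HasDerivAt (fun s => gaussAvg 1 s f x) (s * gaussAvg 1 s (lap f) x) s := by
  have hc := hf.continuous
  have hcd : ∀ i, Continuous (partialDeriv i f) := fun i => (hf.partialDeriv i).continuous
  choose C hC using fun i => (hf.partialDeriv i).exists_bound
  have hX : ∀ i z, gaussKernel (MvPolynomial.X i : MvPolynomial (Fin d) ℝ) z =
      z i * gaussKernel 1 z := fun i z => by simp [gaussKernel]
  have hd : ∀ z : Fin d → ℝ, ∀ s : ℝ, HasDerivAt (fun s : ℝ => gaussKernel 1 z * f (x + s • z))
      (∑ i, gaussKernel (MvPolynomial.X i) z * partialDeriv i f (x + s • z)) s := fun z s => by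
    have h1 : HasDerivAt (fun t : ℝ => x + t • z) z s := by
      simpa using ((hasDerivAt_id s).smul_const z).const_add x
    refine (((hf.differentiable (x + s • z)).hasFDerivAt.comp_hasDerivAt s h1).const_mul
      (gaussKernel 1 z)).congr_deriv ?_
    rw [fderiv_apply_eq_sum, Finset.mul_sum]
    exact Finset.sum_congr rfl fun i _ => by rw [hX]; ring
  have key := hasDerivAt_integral_of_dominated_loc_of_deriv_le (x₀ := s) (s := Set.univ)
    (F := fun s z => gaussKernel 1 z * f (x + s • z)) (μ := (volume : Measure (Fin d → ℝ)))
    (F' := fun s z => ∑ i, gaussKernel (MvPolynomial.X i) z * partialDeriv i f (x + s • z))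
    (bound := fun z => ∑ i, ‖gaussKernel (MvPolynomial.X i) z‖ * C i) Filter.univ_mem
    (Filter.Eventually.of_forall fun s =>
      (integrable_gaussKernel_mul 1 hf x s).aestronglyMeasurable)
    (integrable_gaussKernel_mul 1 hf x s)
    (integrable_finsetSum _ fun i _ =>
      integrable_gaussKernel_mul _ (hf.partialDeriv i) x s).aestronglyMeasurable
    (ae_of_all _ fun z s _ => (norm_sum_le _ _).trans (Finset.sum_le_sum fun i _ => by
      rw [norm_mul]; exact mul_le_mul_of_nonneg_left (hC i _) (norm_nonneg _)))
    (integrable_finsetSum _ fun i _ => (integrable_gaussKernel _).norm.mul_const _)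
    (ae_of_all _ fun z s _ => hd z s)
  refine key.2.congr_deriv ?_
  rw [integral_finsetSum _ fun i _ => integrable_gaussKernel_mul _ (hf.partialDeriv i) x s]
  have hlap : gaussAvg 1 s (lap f) x =
      ∑ i, gaussAvg 1 s (partialDeriv i (partialDeriv i f)) x := by
    simp only [gaussAvg, lap, Finset.mul_sum]
    exact integral_finsetSum _ fun i _ =>
      integrable_gaussKernel_mul _ ((hf.partialDeriv i).partialDeriv i) x s
  rw [hlap, Finset.mul_sum]
  refine Finset.sum_congr rfl fun i _ => ?_
  rw [mul_gaussAvg_partialDeriv 1 (hf.partialDeriv i)]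
  simp [gaussAvg]

lemma continuous_gaussAvg (P : MvPolynomial (Fin d) ℝ) {f : (Fin d → ℝ) → ℝ}
    (hf : SmoothPeriodic f) (x : Fin d → ℝ) : Continuous fun s => gaussAvg P s f x := by
  obtain ⟨C, hC⟩ := hf.exists_bound
  have hc := hf.continuous
  refine continuous_of_dominated (bound := fun z => ‖gaussKernel P z‖ * C)
    (fun s => (integrable_gaussKernel_mul P hf x s).aestronglyMeasurable)
    (fun s => ae_of_all _ fun z => ?_) ((integrable_gaussKernel P).norm.mul_const _)
    (ae_of_all _ fun z => by fun_prop)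
  rw [norm_mul]
  exact mul_le_mul_of_nonneg_left (hC _) (norm_nonneg _)

lemma gaussKernel_one (z : Fin d → ℝ) : gaussKernel 1 z = gauss z := by simp [gaussKernel]

lemma gaussAvg_zero (f : (Fin d → ℝ) → ℝ) (x : Fin d → ℝ) : gaussAvg 1 0 f x = f x := by
  simp only [gaussAvg, zero_smul, add_zero, integral_mul_const, gaussKernel_one, integral_gauss,
    one_mul]

lemma gaussAvg_one_sub {f : (Fin d → ℝ) → ℝ} (hf : SmoothPeriodic f) (x : Fin d → ℝ) :
    gaussAvg 1 1 f x - ∫ s in (0 : ℝ)..1, s * gaussAvg 1 s (lap f) x = f x := by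
  have hc := continuous_gaussAvg 1 hf.lap x
  rw [intervalIntegral.integral_eq_sub_of_hasDerivAt (fun s _ => hasDerivAt_gaussAvg hf x s)
    (Continuous.intervalIntegrable (by fun_prop) _ _), gaussAvg_zero]
  ring

lemma gaussAvg_one_sub_lap {f : (Fin d → ℝ) → ℝ} (hf : SmoothPeriodic f) (x : Fin d → ℝ) :
    f x = gaussAvg 1 1 f x - 2⁻¹ * gaussAvg 1 1 (lap f) x +
      2⁻¹ * ∫ s in (0 : ℝ)..1, s ^ 3 * gaussAvg 1 s (lap (lap f)) x := by
  have hc := continuous_gaussAvg 1 hf.lap.lap x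
  have hd : ∀ s : ℝ, HasDerivAt
      (fun s => gaussAvg 1 s f x - 2⁻¹ * (s ^ 2 * gaussAvg 1 s (lap f) x))
      (-2⁻¹ * (s ^ 3 * gaussAvg 1 s (lap (lap f)) x)) s := fun s => by
    refine ((hasDerivAt_gaussAvg hf x s).sub
      (((hasDerivAt_pow 2 s).mul (hasDerivAt_gaussAvg hf.lap x s)).const_mul 2⁻¹)).congr_deriv ?_
    simp only [Nat.cast_ofNat, Nat.add_one_sub_one, pow_one]
    ring
  have key := intervalIntegral.integral_eq_sub_of_hasDerivAt (a := 0) (b := 1)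
    (fun s _ => hd s) (Continuous.intervalIntegrable (by fun_prop) _ _)
  rw [intervalIntegral.integral_const_mul, gaussAvg_zero] at key
  linarith

/-- The kernel of `-∂ₐ∂_b∂_c` applied to the Gaussian. -/
noncomputable def hermiteThree (a b c : Fin d) : MvPolynomial (Fin d) ℝ :=
  let D := fun (i : Fin d) (P : MvPolynomial (Fin d) ℝ) =>
    MvPolynomial.X i * P - MvPolynomial.pderiv i P
  D c (D b (D a 1))

lemma pow_three_mul_gaussAvg {f : (Fin d → ℝ) → ℝ} (hf : SmoothPeriodic f) (x : Fin d → ℝ)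
    (s : ℝ) (a b c : Fin d) :
    s ^ 3 * gaussAvg 1 s (partialDeriv a (partialDeriv b (partialDeriv c f))) x =
      gaussAvg (hermiteThree a b c) s f x := by
  rw [pow_succ, pow_two, mul_assoc, mul_assoc,
    mul_gaussAvg_partialDeriv _ ((hf.partialDeriv c).partialDeriv b),
    mul_gaussAvg_partialDeriv _ (hf.partialDeriv c), mul_gaussAvg_partialDeriv _ hf]
  rfl

end Gaussian

section Inverse

variable {d : ℕ}

lemma avg_withDensity_ofReal {h : (Fin d → ℝ) → ℝ} (hm : Measurable h) (h0 : ∀ z, 0 ≤ h z)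
    (f : (Fin d → ℝ) → ℝ) (x : Fin d → ℝ) :
    avg (volume.withDensity fun z => ENNReal.ofReal (h z)) f x = ∫ z, h z * f (x + z) := by
  rw [avg, integral_withDensity_eq_integral_toReal_smul hm.ennreal_ofReal
    (ae_of_all _ fun _ => ENNReal.ofReal_lt_top)]
  simp only [ENNReal.toReal_ofReal (h0 _), smul_eq_mul]

/-- The standard Gaussian measure on `ℝ^d`. -/
noncomputable def gaussMeasure (d : ℕ) : Measure (Fin d → ℝ) :=
  volume.withDensity fun z => ENNReal.ofReal (gauss z)

lemma integrable_gauss : Integrable (gauss : (Fin d → ℝ) → ℝ) :=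
  (funext gaussKernel_one : gaussKernel 1 = gauss) ▸ integrable_gaussKernel 1

instance (d : ℕ) : IsFiniteMeasure (gaussMeasure d) :=
  isFiniteMeasure_withDensity_ofReal integrable_gauss.2

lemma integral_gaussMeasure (f : (Fin d → ℝ) → ℝ) (x : Fin d → ℝ) (s : ℝ) :
    ∫ z, f (x + s • z) ∂gaussMeasure d = gaussAvg 1 s f x := by
  rw [gaussMeasure, integral_withDensity_eq_integral_toReal_smul
    continuous_gauss.measurable.ennreal_ofReal (ae_of_all _ fun _ => ENNReal.ofReal_lt_top)]
  simp only [ENNReal.toReal_ofReal (gauss_pos _).le, smul_eq_mul, gaussAvg, gaussKernel_one]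

lemma avg_gaussMeasure (f : (Fin d → ℝ) → ℝ) : avg (gaussMeasure d) f = gaussAvg 1 1 f := by
  funext x
  rw [← integral_gaussMeasure]
  simp [avg]

/-- The measure `s ds` on `(0, 1]`. -/
noncomputable def radialMeasure : Measure ℝ :=
  (volume.restrict (Set.Ioc (0 : ℝ) 1)).withDensity fun s => ENNReal.ofReal s

instance : IsFiniteMeasure radialMeasure :=
  isFiniteMeasure_withDensity_ofReal
    ((continuous_id.integrableOn_Icc (a := (0 : ℝ)) (b := 1)).mono_set Set.Ioc_subset_Icc_self).2

/-- The image of `s ds ⊗ γ` under dilation, where `γ` is the Gaussian measure. -/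
noncomputable def heatMeasure (d : ℕ) : Measure (Fin d → ℝ) :=
  (radialMeasure.prod (gaussMeasure d)).map fun p => p.1 • p.2

instance (d : ℕ) : IsFiniteMeasure (heatMeasure d) := by
  rw [heatMeasure]; infer_instance

lemma avg_heatMeasure {f : (Fin d → ℝ) → ℝ} (hf : SmoothPeriodic f) (x : Fin d → ℝ) :
    avg (heatMeasure d) f x = ∫ s in (0 : ℝ)..1, s * gaussAvg 1 s f x := by
  have hm : Measurable fun p : ℝ × (Fin d → ℝ) => p.1 • p.2 := by fun_prop
  rw [avg, heatMeasure, integral_map hm.aemeasurable (hf.integrable_add x).aestronglyMeasurable,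
    integral_prod _ (hf.integrable_comp (y := fun p : ℝ × (Fin d → ℝ) => x + p.1 • p.2)
      (by fun_prop))]
  simp only [integral_gaussMeasure]
  rw [radialMeasure, integral_withDensity_eq_integral_toReal_smul
    ENNReal.measurable_ofReal (ae_of_all _ fun _ => ENNReal.ofReal_lt_top),
    intervalIntegral.integral_of_le zero_le_one]
  exact setIntegral_congr_fun measurableSet_Ioc fun s hs => by
    simp only [ENNReal.toReal_ofReal hs.1.le, smul_eq_mul]

lemma avg_heatMeasure_lap {f : (Fin d → ℝ) → ℝ} (hf : SmoothPeriodic f) (x : Fin d → ℝ) :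
    avg (heatMeasure d) (lap f) x = avg (gaussMeasure d) f x - f x := by
  rw [avg_heatMeasure hf.lap, avg_gaussMeasure]
  linarith [gaussAvg_one_sub hf x]

lemma volume_box_ne_top : volume (box d) ≠ ⊤ := isCompact_Icc.measure_lt_top.ne

lemma volume_real_box_pos : 0 < volume.real (box d) := by
  rw [measureReal_def, box, Real.volume_Icc_pi_toReal fun i => by positivity]
  exact Finset.prod_pos fun i _ => by simp [Real.pi_pos]

/-- The Gaussian measure dominates a multiple of Lebesgue measure on the period box; the remainder
has mass less than one and the same averages on mean-zero functions. -/
lemma exists_contraction_measure (d : ℕ) :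
    ∃ (q : Measure (Fin d → ℝ)) (δ : ℝ), IsFiniteMeasure q ∧ q Set.univ < 1 ∧
      ∀ f : (Fin d → ℝ) → ℝ, SmoothPeriodic f → ∀ x,
        avg (gaussMeasure d) f x = avg q f x + δ * ∫ y in box d, f y := by
  obtain ⟨z₀, -, hz₀⟩ := (isCompact_Icc (a := (0 : Fin d → ℝ)) (b := fun _ => 2 * π)).exists_isMinOn
    ⟨0, le_rfl, fun i => by simp [Real.pi_pos.le]⟩ continuous_gauss.continuousOn
  have hb : MeasurableSet (box d) := measurableSet_Icc
  set δ := gauss z₀ with hδ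
  set h : (Fin d → ℝ) → ℝ := fun z => gauss z - (box d).indicator (fun _ => δ) z with hh
  have hδ0 : 0 < δ := gauss_pos z₀
  have h0 : ∀ z, 0 ≤ h z := fun z => by
    by_cases hz : z ∈ box d
    · simp only [hh, Set.indicator_of_mem hz, sub_nonneg]
      exact hz₀ hz
    · simp only [hh, Set.indicator_of_notMem hz, sub_zero]
      exact (gauss_pos z).le
  have hm : Measurable h :=
    continuous_gauss.measurable.sub (measurable_const.indicator hb)
  have hind : Integrable ((box d).indicator fun _ => δ) :=
    (integrable_indicator_iff hb).2 (integrableOn_const volume_box_ne_top)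
  have hi : Integrable h := integrable_gauss.sub hind
  have hfin : IsFiniteMeasure (volume.withDensity fun z => ENNReal.ofReal (h z)) :=
    isFiniteMeasure_withDensity_ofReal hi.2
  refine ⟨volume.withDensity fun z => ENNReal.ofReal (h z), δ, hfin, ?_, fun f hf x => ?_⟩
  · rw [withDensity_apply _ MeasurableSet.univ, setLIntegral_univ,
      ← ofReal_integral_eq_lintegral_ofReal hi (ae_of_all _ h0), ENNReal.ofReal_lt_one,
      integral_sub integrable_gauss hind, integral_gauss, integral_indicator hb, setIntegral_const,
      smul_eq_mul]
    have := mul_pos (volume_real_box_pos (d := d)) hδ0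
    linarith
  · obtain ⟨C, hC⟩ := hf.exists_bound
    have hc := hf.continuous
    have hmx : AEStronglyMeasurable (fun z => f (x + z)) :=
      Continuous.aestronglyMeasurable (by fun_prop)
    rw [avg_withDensity_ofReal hm h0, gaussMeasure, avg_withDensity_ofReal
      continuous_gauss.measurable fun z => (gauss_pos z).le]
    have h1 : ∀ z, h z * f (x + z) =
        gauss z * f (x + z) - (box d).indicator (fun z => δ * f (x + z)) z := fun z => by
      by_cases hz : z ∈ box d
      · simp only [hh, Set.indicator_of_mem hz]; ring
      · simp only [hh, Set.indicator_of_notMem hz]; ring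
    have hi2 : Integrable ((box d).indicator fun z => δ * f (x + z)) := by
      refine (integrable_indicator_iff hb).2 (Continuous.continuousOn ?_ |>.integrableOn_compact
        isCompact_Icc)
      fun_prop
    have h2 : ∫ z in box d, δ * f (x + z) = δ * ∫ y in box d, f y := by
      rw [integral_const_mul, ← hf.2.setIntegral_add x]
      simp only [add_comm x]
    simp only [h1]
    rw [integral_sub (integrable_gauss.mul_bdd hmx (ae_of_all _ fun z => hC _)) hi2,
      integral_indicator hb, h2]
    ring

/-- An inverse of the Laplacian on mean-zero smooth periodic functions. -/
structure IsInverseLaplacian (L : ((Fin d → ℝ) → ℝ) → (Fin d → ℝ) → ℝ) : Prop where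
  smoothPeriodic : ∀ {f}, SmoothPeriodic f → SmoothPeriodic (L f)
  add : ∀ {f g}, SmoothPeriodic f → SmoothPeriodic g →
    L (fun x => f x + g x) = fun x => L f x + L g x
  const_mul : ∀ {f}, SmoothPeriodic f → ∀ c : ℝ, L (fun x => c * f x) = fun x => c * L f x
  comm_partialDeriv : ∀ {f}, SmoothPeriodic f → ∀ i, partialDeriv i (L f) = L (partialDeriv i f)
  exists_lap : ∃ K : ℝ, ∀ f, SmoothPeriodic f → ∀ x, lap (L f) x = f x - K * ∫ y in box d, f y
  exists_bound : ∃ C : ENNReal, C ≠ ⊤ ∧ ∀ p : ℝ, 1 ≤ p → ∀ f, SmoothPeriodic f →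
    eLpNorm (L f) (ENNReal.ofReal p) (volume.restrict (box d)) ≤
      C * eLpNorm f (ENNReal.ofReal p) (volume.restrict (box d))

lemma exists_isInverseLaplacian (d : ℕ) :
    ∃ L : ((Fin d → ℝ) → ℝ) → (Fin d → ℝ) → ℝ, IsInverseLaplacian L := by
  obtain ⟨q, δ, _, hq1, hq⟩ := exists_contraction_measure d
  obtain ⟨ρ, _, hρ⟩ := exists_geometric_measure q hq1
  refine ⟨fun f x => -1 * avg ρ (avg (heatMeasure d) f) x, ?_⟩
  have hsp : ∀ {f : (Fin d → ℝ) → ℝ}, SmoothPeriodic f →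
      SmoothPeriodic (avg ρ (avg (heatMeasure d) f)) := fun hf => hf.avg.avg
  refine ⟨fun hf => (hsp hf).const_smul (-1), fun hf hg => ?_, fun hf c => ?_, fun hf i => ?_,
    ⟨δ * ρ.real Set.univ, fun f hf x => ?_⟩, ⟨ρ Set.univ * heatMeasure d Set.univ,
    ENNReal.mul_ne_top (measure_ne_top _ _) (measure_ne_top _ _), fun p hp f hf => ?_⟩⟩
  · rw [avg_add hf hg, avg_add hf.avg hg.avg]
    funext x
    ring
  · rw [avg_const_mul, avg_const_mul]
    funext x
    ring
  · rw [partialDeriv_const_mul (hsp hf), partialDeriv_avg hf.avg, partialDeriv_avg hf]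
  · have hlin : lap (fun x => -1 * avg ρ (avg (heatMeasure d) f) x) x =
        -1 * lap (avg ρ (avg (heatMeasure d) f)) x := by
      simp only [lap, partialDeriv_const_mul (hsp hf),
        partialDeriv_const_mul ((hsp hf).partialDeriv _), Finset.mul_sum]
    have h1 : avg (heatMeasure d) (lap f) =
        fun x => avg q f x + (δ * (∫ y in box d, f y) + -1 * f x) := funext fun x => by
      rw [avg_heatMeasure_lap hf, hq f hf]; ring
    have hneg : SmoothPeriodic fun x => -1 * f x := hf.const_smul (-1)
    have h2 : avg ρ (fun _ => δ * (∫ y in box d, f y)) x =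
        ρ.real Set.univ * (δ * (∫ y in box d, f y)) := by
      simp [avg]
    rw [hlin, lap_avg hf.avg, lap_avg hf, h1, avg_add hf.avg ((SmoothPeriodic.const _).add hneg),
      avg_add (SmoothPeriodic.const _) hneg, avg_const_mul f (-1)]
    simp only [h2]
    linarith [hρ f hf x]
  · have hneg : eLpNorm (fun x => -1 * avg ρ (avg (heatMeasure d) f) x) (ENNReal.ofReal p)
        (volume.restrict (box d)) = eLpNorm (avg ρ (avg (heatMeasure d) f)) (ENNReal.ofReal p)
        (volume.restrict (box d)) := by
      simp only [neg_one_mul]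
      exact eLpNorm_neg _ _ _
    rw [hneg, mul_assoc]
    exact (eLpNorm_avg_le ρ hf.avg hp).trans (mul_le_mul_right (eLpNorm_avg_le _ hf hp) _)

end Inverse

section ThirdDerivative

variable {d : ℕ}

/-- The total variation of the measure with density `gaussKernel P`. -/
noncomputable def kernelMeasure (P : MvPolynomial (Fin d) ℝ) : Measure (Fin d → ℝ) :=
  volume.withDensity fun z => ‖gaussKernel P z‖ₑ

instance (P : MvPolynomial (Fin d) ℝ) : IsFiniteMeasure (kernelMeasure P) :=
  isFiniteMeasure_withDensity (integrable_gaussKernel P).2.ne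

lemma enorm_gaussAvg_le (P : MvPolynomial (Fin d) ℝ) {f : (Fin d → ℝ) → ℝ}
    (hf : SmoothPeriodic f) (s : ℝ) (x : Fin d → ℝ) :
    ‖gaussAvg P s f x‖ₑ ≤ ∫⁻ z, ‖f (x + s • z)‖ₑ ∂kernelMeasure P := by
  have hc := hf.continuous
  refine (enorm_integral_le_lintegral_enorm _).trans_eq ?_
  rw [kernelMeasure, lintegral_withDensity_eq_lintegral_mul _
    (continuous_gaussKernel P).measurable.enorm (Continuous.measurable (by fun_prop))]
  simp only [Pi.mul_apply, enorm_mul]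

lemma eLpNorm_gaussAvg_le (P : MvPolynomial (Fin d) ℝ) {f : (Fin d → ℝ) → ℝ}
    (hf : SmoothPeriodic f) {p : ℝ} (hp : 1 ≤ p) :
    eLpNorm (gaussAvg P 1 f) (ENNReal.ofReal p) (volume.restrict (box d)) ≤
      kernelMeasure P Set.univ * eLpNorm f (ENNReal.ofReal p) (volume.restrict (box d)) :=
  eLpNorm_le_of_enorm_le_lintegral (kernelMeasure P) (measurable_const_smul (1 : ℝ)) hf
    (enorm_gaussAvg_le P hf 1) hp

lemma eLpNorm_integral_gaussAvg_le (P : MvPolynomial (Fin d) ℝ) {f : (Fin d → ℝ) → ℝ}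
    (hf : SmoothPeriodic f) {p : ℝ} (hp : 1 ≤ p) :
    eLpNorm (fun x => ∫ s in (0 : ℝ)..1, gaussAvg P s f x) (ENNReal.ofReal p)
        (volume.restrict (box d)) ≤
      kernelMeasure P Set.univ * eLpNorm f (ENNReal.ofReal p) (volume.restrict (box d)) := by
  have hc := hf.continuous
  have hm : Measurable fun a : ℝ × (Fin d → ℝ) => a.1 • a.2 := by fun_prop
  have h := eLpNorm_le_of_enorm_le_lintegral
    ((volume.restrict (Set.Ioc (0 : ℝ) 1)).prod (kernelMeasure P)) hm hf
    (g := fun x => ∫ s in (0 : ℝ)..1, gaussAvg P s f x) (fun x => ?_) hp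
  · simpa [Measure.prod_apply] using! h
  · rw [intervalIntegral.integral_of_le zero_le_one,
      lintegral_prod _ (Continuous.aemeasurable (by fun_prop))]
    exact (enorm_integral_le_lintegral_enorm _).trans
      (lintegral_mono fun s => enorm_gaussAvg_le P hf s x)

/-- `L^p` bound on third derivatives of `w`, where `Δw = u` and `Δu = f` up to constants. -/
lemma eLpNorm_partialDeriv_three_le {w u f : (Fin d → ℝ) → ℝ} (hw : SmoothPeriodic w)
    (hu : SmoothPeriodic u) (hf : SmoothPeriodic f)
    (hwu : ∀ c, partialDeriv c (lap w) = partialDeriv c u)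
    (huf : ∀ c, partialDeriv c (lap u) = partialDeriv c f) (a b c : Fin d) {p : ℝ} (hp : 1 ≤ p) :
    eLpNorm (partialDeriv a (partialDeriv b (partialDeriv c w))) (ENNReal.ofReal p)
        (volume.restrict (box d)) ≤
      kernelMeasure (hermiteThree a b c) Set.univ *
        (eLpNorm w (ENNReal.ofReal p) (volume.restrict (box d)) +
          eLpNorm u (ENNReal.ofReal p) (volume.restrict (box d)) +
          eLpNorm f (ENNReal.ofReal p) (volume.restrict (box d))) := by
  set H := hermiteThree a b c with hH
  set U := partialDeriv a (partialDeriv b (partialDeriv c w)) with hU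
  have hUs : SmoothPeriodic U := ((hw.partialDeriv c).partialDeriv b).partialDeriv a
  have hlap : ∀ {g h : (Fin d → ℝ) → ℝ}, SmoothPeriodic g →
      (∀ c, partialDeriv c (lap g) = partialDeriv c h) →
      lap (partialDeriv a (partialDeriv b (partialDeriv c g))) =
        partialDeriv a (partialDeriv b (partialDeriv c h)) := fun hg hgh => by
    rw [lap_partialDeriv ((hg.partialDeriv c).partialDeriv b), lap_partialDeriv (hg.partialDeriv c),
      lap_partialDeriv hg, hgh]
  have hg : ∀ {g : (Fin d → ℝ) → ℝ}, SmoothPeriodic g →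
      gaussAvg 1 1 (partialDeriv a (partialDeriv b (partialDeriv c g))) = gaussAvg H 1 g :=
    fun hg => funext fun x => by rw [← pow_three_mul_gaussAvg hg]; ring
  have hcont : ∀ {g : (Fin d → ℝ) → ℝ}, SmoothPeriodic g → Continuous (gaussAvg H 1 g) :=
    fun hg' => by
      rw [← hg hg', ← avg_gaussMeasure]
      exact (((hg'.partialDeriv c).partialDeriv b).partialDeriv a).avg.continuous
  have hrep : U = (gaussAvg H 1 w + (-2⁻¹ : ℝ) • gaussAvg H 1 u) +
      (2⁻¹ : ℝ) • fun x => ∫ s in (0 : ℝ)..1, gaussAvg H s f x := funext fun x => by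
    have h := gaussAvg_one_sub_lap hUs x
    rw [hU, hlap hw hwu, hlap hu huf, hg hw, hg hu] at h
    simp only [pow_three_mul_gaussAvg hf] at h
    rw [hU, h]
    simp only [Pi.add_apply, Pi.smul_apply, smul_eq_mul]
    ring
  have hw' := hcont hw
  have hu' := hcont hu
  have hm : Continuous fun x => (2⁻¹ : ℝ) * ∫ s in (0 : ℝ)..1, gaussAvg H s f x := by
    have hUc := hUs.continuous
    have : (fun x => (2⁻¹ : ℝ) * ∫ s in (0 : ℝ)..1, gaussAvg H s f x) =
        fun x => U x - (gaussAvg H 1 w x + -2⁻¹ * gaussAvg H 1 u x) := funext fun x => by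
      have := congrFun hrep x
      simp only [Pi.add_apply, Pi.smul_apply, smul_eq_mul] at this
      linarith
    rw [this]
    fun_prop
  have hp' : (1 : ENNReal) ≤ ENNReal.ofReal p := by simpa using hp
  have hn : ∀ {r : ℝ}, |r| ≤ 1 → ∀ g : (Fin d → ℝ) → ℝ,
      eLpNorm (r • g) (ENNReal.ofReal p) (volume.restrict (box d)) ≤
        eLpNorm g (ENNReal.ofReal p) (volume.restrict (box d)) := fun {r} hr g =>
    eLpNorm_mono fun x => by
      simpa using mul_le_mul_of_nonneg_right hr (abs_nonneg (g x))
  rw [hrep, mul_add, mul_add]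
  refine (eLpNorm_add_le (hw'.add (hu'.const_smul (-2⁻¹ : ℝ))).aestronglyMeasurable
    hm.aestronglyMeasurable hp').trans (add_le_add ((eLpNorm_add_le hw'.aestronglyMeasurable
    (hu'.const_smul (-2⁻¹ : ℝ)).aestronglyMeasurable hp').trans (add_le_add
    (eLpNorm_gaussAvg_le H hw hp) ?_)) ?_)
  · exact (hn (by norm_num [abs_le]) _).trans (eLpNorm_gaussAvg_le H hu hp)
  · exact (hn (by norm_num [abs_le]) _).trans (eLpNorm_integral_gaussAvg_le H hf hp)

namespace IsInverseLaplacian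

variable {L : ((Fin d → ℝ) → ℝ) → (Fin d → ℝ) → ℝ}

lemma partialDeriv_lap (hL : IsInverseLaplacian L) {f : (Fin d → ℝ) → ℝ} (hf : SmoothPeriodic f)
    (i : Fin d) : partialDeriv i (lap (L f)) = partialDeriv i f := by
  obtain ⟨K, hK⟩ := hL.exists_lap
  have : lap (L f) = fun x => f x - K * ∫ y in box d, f y := funext (hK f hf)
  rw [this, partialDeriv_sub_const]

lemma lap_eq (hL : IsInverseLaplacian L) {f : (Fin d → ℝ) → ℝ} (hf : SmoothPeriodic f)
    (h0 : ∫ y in box d, f y = 0) : lap (L f) = f := by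
  obtain ⟨K, hK⟩ := hL.exists_lap
  exact funext fun x => by rw [hK f hf, h0, mul_zero, sub_zero]

lemma map_zero (hL : IsInverseLaplacian L) : L (fun _ => 0) = fun _ => 0 := by
  simpa using hL.const_mul (SmoothPeriodic.const (0 : ℝ)) 0

lemma map_sum (hL : IsInverseLaplacian L) {ι : Type*} (s : Finset ι)
    {f : ι → (Fin d → ℝ) → ℝ} (hf : ∀ k, SmoothPeriodic (f k)) :
    L (fun x => ∑ k ∈ s, f k x) = fun x => ∑ k ∈ s, L (f k) x := by
  classical
  induction s using Finset.induction_on with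
  | empty => simpa using hL.map_zero
  | insert k s hk ih =>
    simp only [Finset.sum_insert hk]
    rw [hL.add (hf k) (.sum s fun k _ => hf k), ih]

lemma map_lap (hL : IsInverseLaplacian L) {f : (Fin d → ℝ) → ℝ} (hf : SmoothPeriodic f) :
    L (lap f) = lap (L f) := by
  unfold lap
  rw [hL.map_sum _ fun l => (hf.partialDeriv l).partialDeriv l]
  simp only [hL.comm_partialDeriv hf, hL.comm_partialDeriv (hf.partialDeriv _)]

/-- Third derivatives of the biharmonic potential are bounded on `L^p`. -/
lemma exists_bound_partialDeriv_three (hL : IsInverseLaplacian L) :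
    ∃ C : ENNReal, C ≠ ⊤ ∧ ∀ p : ℝ, 1 ≤ p → ∀ (a b c : Fin d) (f), SmoothPeriodic f →
      eLpNorm (partialDeriv a (partialDeriv b (partialDeriv c (L (L f)))))
          (ENNReal.ofReal p) (volume.restrict (box d)) ≤
        C * eLpNorm f (ENNReal.ofReal p) (volume.restrict (box d)) := by
  obtain ⟨C, hC, hb⟩ := hL.exists_bound
  refine ⟨(∑ a, ∑ b, ∑ c, kernelMeasure (hermiteThree (d := d) a b c) Set.univ) * (C * C + C + 1),
    ENNReal.mul_ne_top (by simp [ENNReal.sum_eq_top]) (by finiteness), fun p hp a b c f hf => ?_⟩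
  have hf' := hL.smoothPeriodic hf
  have h1 := hb p hp f hf
  have h2 := (hb p hp _ hf').trans (mul_le_mul_right h1 C)
  have hsum : kernelMeasure (hermiteThree a b c) Set.univ ≤
      ∑ a, ∑ b, ∑ c, kernelMeasure (hermiteThree (d := d) a b c) Set.univ := by
    refine le_trans ?_ (Finset.single_le_sum (fun _ _ => zero_le) (Finset.mem_univ a))
    refine le_trans ?_ (Finset.single_le_sum (fun _ _ => zero_le) (Finset.mem_univ b))
    exact Finset.single_le_sum (f := fun c => kernelMeasure (hermiteThree a b c) Set.univ)
      (fun _ _ => zero_le) (Finset.mem_univ c)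
  refine (eLpNorm_partialDeriv_three_le (hL.smoothPeriodic hf') hf' hf (hL.partialDeriv_lap hf')
    (hL.partialDeriv_lap hf) a b c hp).trans ?_
  rw [mul_assoc, add_mul, add_mul, one_mul, mul_assoc]
  exact mul_le_mul' hsum (add_le_add (add_le_add h2 h1) le_rfl)

end IsInverseLaplacian

end ThirdDerivative

section Stress

variable {d : ℕ}

/-- The symmetric trace-free matrix field
`∂ᵢΔuⱼ + ∂ⱼΔuᵢ - (d - 1)⁻¹ δᵢⱼ div Δu + (2 - d) (d - 1)⁻¹ ∂ᵢ∂ⱼ div u`, with divergence `Δ²u`. -/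
noncomputable def stress (u : Fin d → (Fin d → ℝ) → ℝ) (i j : Fin d) (x : Fin d → ℝ) : ℝ :=
  partialDeriv i (lap (u j)) x + partialDeriv j (lap (u i)) x +
    (if i = j then -((d : ℝ) - 1)⁻¹ else 0) * ∑ k, partialDeriv k (lap (u k)) x +
    (2 - d) / (d - 1) * ∑ k, partialDeriv i (partialDeriv j (partialDeriv k (u k))) x

lemma lap_add {f g : (Fin d → ℝ) → ℝ} (hf : SmoothPeriodic f) (hg : SmoothPeriodic g) :
    lap (fun x => f x + g x) = fun x => lap f x + lap g x := by
  funext x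
  simp only [lap, partialDeriv_add hf hg, partialDeriv_add (hf.partialDeriv _) (hg.partialDeriv _),
    Finset.sum_add_distrib]

lemma lap_const_mul {f : (Fin d → ℝ) → ℝ} (hf : SmoothPeriodic f) (c : ℝ) :
    lap (fun x => c * f x) = fun x => c * lap f x := by
  funext x
  simp only [lap, partialDeriv_const_mul hf, partialDeriv_const_mul (hf.partialDeriv _),
    Finset.mul_sum]

lemma stress_add {u w : Fin d → (Fin d → ℝ) → ℝ} (hu : ∀ k, SmoothPeriodic (u k))
    (hw : ∀ k, SmoothPeriodic (w k)) (i j : Fin d) (x : Fin d → ℝ) :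
    stress (fun k y => u k y + w k y) i j x = stress u i j x + stress w i j x := by
  simp only [stress, lap_add (hu _) (hw _), partialDeriv_add (hu _).lap (hw _).lap,
    partialDeriv_add (hu _) (hw _), partialDeriv_add ((hu _).partialDeriv _) ((hw _).partialDeriv _),
    partialDeriv_add (((hu _).partialDeriv _).partialDeriv _) (((hw _).partialDeriv _).partialDeriv _),
    Finset.sum_add_distrib]
  ring

lemma stress_const_mul {u : Fin d → (Fin d → ℝ) → ℝ} (hu : ∀ k, SmoothPeriodic (u k)) (c : ℝ)
    (i j : Fin d) (x : Fin d → ℝ) :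
    stress (fun k y => c * u k y) i j x = c * stress u i j x := by
  simp only [stress, lap_const_mul (hu _), partialDeriv_const_mul (hu _).lap,
    partialDeriv_const_mul (hu _), partialDeriv_const_mul ((hu _).partialDeriv _),
    partialDeriv_const_mul (((hu _).partialDeriv _).partialDeriv _), ← Finset.mul_sum]
  ring

lemma SmoothPeriodic.stress {u : Fin d → (Fin d → ℝ) → ℝ} (hu : ∀ k, SmoothPeriodic (u k))
    (i j : Fin d) : SmoothPeriodic (stress u i j) :=
  ((((hu j).lap.partialDeriv i).add ((hu i).lap.partialDeriv j)).add
    ((SmoothPeriodic.sum _ fun k _ => (hu k).lap.partialDeriv k).const_smul _)).add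
    ((SmoothPeriodic.sum _ fun k _ =>
      (((hu k).partialDeriv k).partialDeriv j).partialDeriv i).const_smul _)

lemma stress_comm {u : Fin d → (Fin d → ℝ) → ℝ} (hu : ∀ k, SmoothPeriodic (u k))
    (i j : Fin d) (x : Fin d → ℝ) : stress u i j x = stress u j i x := by
  simp only [stress, partialDeriv_comm ((hu _).partialDeriv _) i j, eq_comm (a := i)]
  ring

lemma sum_stress_self (hd : 2 ≤ d) {u : Fin d → (Fin d → ℝ) → ℝ}
    (hu : ∀ k, SmoothPeriodic (u k)) (x : Fin d → ℝ) : ∑ i, stress u i i x = 0 := by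
  have h1 : ((d : ℝ) - 1) ≠ 0 := by
    have : (2 : ℝ) ≤ d := by exact_mod_cast hd
    linarith
  have h2 : ∑ i, ∑ k, partialDeriv i (partialDeriv i (partialDeriv k (u k))) x =
      ∑ k, partialDeriv k (lap (u k)) x := by
    rw [Finset.sum_comm]
    refine Finset.sum_congr rfl fun k _ => ?_
    rw [← lap_partialDeriv (hu k)]
    rfl
  simp only [stress, Finset.sum_add_distrib, if_true, ← Finset.mul_sum, h2, Finset.sum_const,
    Finset.card_univ, Fintype.card_fin, nsmul_eq_mul]
  field_simp
  ring

lemma sum_partialDeriv_stress (hd : 2 ≤ d) {u : Fin d → (Fin d → ℝ) → ℝ}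
    (hu : ∀ k, SmoothPeriodic (u k)) (i : Fin d) (x : Fin d → ℝ) :
    ∑ j, partialDeriv j (stress u i j) x = lap (lap (u i)) x := by
  have h1 : ((d : ℝ) - 1) ≠ 0 := by
    have : (2 : ℝ) ≤ d := by exact_mod_cast hd
    linarith
  have hA : ∀ k, SmoothPeriodic fun x => partialDeriv k (lap (u k)) x := fun k =>
    (hu k).lap.partialDeriv k
  have hE : ∀ j k, SmoothPeriodic fun x => partialDeriv i (partialDeriv j (partialDeriv k (u k))) x :=
    fun j k => (((hu k).partialDeriv k).partialDeriv j).partialDeriv i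
  have hstress : ∀ j, partialDeriv j (stress u i j) x =
      partialDeriv i (partialDeriv j (lap (u j))) x + partialDeriv j (partialDeriv j (lap (u i))) x +
      (if i = j then -((d : ℝ) - 1)⁻¹ else 0) * ∑ k, partialDeriv j (partialDeriv k (lap (u k))) x +
      (2 - d) / (d - 1) *
        ∑ k, partialDeriv i (partialDeriv j (partialDeriv j (partialDeriv k (u k)))) x := fun j => by
    have h2 : SmoothPeriodic fun x => partialDeriv i (lap (u j)) x := (hu j).lap.partialDeriv i
    have h3 : SmoothPeriodic fun x => partialDeriv j (lap (u i)) x := (hu i).lap.partialDeriv j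
    have h4 := SmoothPeriodic.sum Finset.univ fun k _ => hA k
    have h5 := SmoothPeriodic.sum Finset.univ fun k _ => hE j k
    unfold stress
    rw [partialDeriv_add ((h2.add h3).add (h4.const_mul _)) (h5.const_mul _),
      partialDeriv_add (h2.add h3) (h4.const_mul _), partialDeriv_add h2 h3,
      partialDeriv_const_mul h4, partialDeriv_const_mul h5, partialDeriv_sum _ fun k _ => hA k,
      partialDeriv_sum _ fun k _ => hE j k]
    simp only [partialDeriv_comm (hu j).lap i j,
      partialDeriv_comm (((hu _).partialDeriv _).partialDeriv j) i j]
  have h6 : ∑ j, ∑ k, partialDeriv i (partialDeriv j (partialDeriv j (partialDeriv k (u k)))) x =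
      ∑ k, partialDeriv i (partialDeriv k (lap (u k))) x := by
    rw [Finset.sum_comm]
    refine Finset.sum_congr rfl fun k _ => ?_
    rw [← lap_partialDeriv (hu k)]
    exact (congrFun (partialDeriv_sum Finset.univ
      (fun l _ => (((hu k).partialDeriv k).partialDeriv l).partialDeriv l) i) x).symm
  simp only [hstress, Finset.sum_add_distrib, ← Finset.mul_sum, h6, ite_mul, zero_mul,
    Finset.sum_ite_eq, Finset.mem_univ, if_true]
  change _ + lap (lap (u i)) x + _ + _ = _
  field_simp
  ring

/-- The sum of the absolute values of all third derivatives. -/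
noncomputable def thirdDerivSum (u : Fin d → (Fin d → ℝ) → ℝ) (x : Fin d → ℝ) : ℝ :=
  ∑ q : Fin d × Fin d × Fin d × Fin d,
    ‖partialDeriv q.1 (partialDeriv q.2.1 (partialDeriv q.2.2.1 (u q.2.2.2))) x‖

lemma abs_stress_le {u : Fin d → (Fin d → ℝ) → ℝ} (hu : ∀ k, SmoothPeriodic (u k))
    (i j : Fin d) (x : Fin d → ℝ) :
    |stress u i j x| ≤
      (d + d + |((d : ℝ) - 1)⁻¹| * (d * d) + |(2 - d : ℝ) / (d - 1)| * d) * thirdDerivSum u x := by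
  have hS : ∀ a b c k, |partialDeriv a (partialDeriv b (partialDeriv c (u k))) x| ≤
      thirdDerivSum u x := fun a b c k =>
    Finset.single_le_sum (f := fun q : Fin d × Fin d × Fin d × Fin d =>
      ‖partialDeriv q.1 (partialDeriv q.2.1 (partialDeriv q.2.2.1 (u q.2.2.2))) x‖)
      (fun _ _ => norm_nonneg _) (Finset.mem_univ (a, b, c, k))
  have hS0 : 0 ≤ thirdDerivSum u x := Finset.sum_nonneg fun _ _ => norm_nonneg _
  have hsum : ∀ {g : Fin d → ℝ} {B : ℝ}, (∀ k, |g k| ≤ B) → |∑ k, g k| ≤ d * B := fun hg =>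
    (Finset.abs_sum_le_sum_abs _ _).trans ((Finset.sum_le_sum fun k _ => hg k).trans (by simp))
  have hl : ∀ a k, |partialDeriv a (lap (u k)) x| ≤ d * thirdDerivSum u x := fun a k => by
    have := congrFun (partialDeriv_sum Finset.univ
      (fun l _ => ((hu k).partialDeriv l).partialDeriv l) a) x
    change partialDeriv a (lap (u k)) x = _ at this
    rw [this]
    exact hsum fun l => hS a l l k
  have h1 : |if i = j then -((d : ℝ) - 1)⁻¹ else 0| ≤ |((d : ℝ) - 1)⁻¹| := by
    split_ifs <;> simp
  have h2 : |∑ k, partialDeriv k (lap (u k)) x| ≤ d * (d * thirdDerivSum u x) :=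
    hsum fun k => hl k k
  have h3 : |∑ k, partialDeriv i (partialDeriv j (partialDeriv k (u k))) x| ≤
      d * thirdDerivSum u x := hsum fun k => hS i j k k
  have h4 := mul_le_mul h1 h2 (abs_nonneg _) (abs_nonneg _)
  have h5 := mul_le_mul_of_nonneg_left h3 (abs_nonneg ((2 - d : ℝ) / (d - 1)))
  rw [← abs_mul] at h4 h5
  refine (abs_add_le _ _).trans ((add_le_add ((abs_add_le _ _).trans (add_le_add
    ((abs_add_le _ _).trans (add_le_add (hl i j) (hl j i))) h4)) h5).trans_eq ?_)
  ring

lemma frobNorm_le_sum (Q : Matrix (Fin d) (Fin d) ℝ) : frobNorm Q ≤ ∑ i, ∑ j, |Q i j| := by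
  have h0 : 0 ≤ ∑ i, ∑ j, |Q i j| := Finset.sum_nonneg fun _ _ => Finset.sum_nonneg fun _ _ =>
    abs_nonneg _
  rw [frobNorm, Real.sqrt_le_left h0, ← Finset.sum_product', ← Finset.sum_product']
  simp only [← sq_abs (Q _ _)]
  exact Finset.sum_sq_le_sq_sum_of_nonneg fun _ _ => abs_nonneg _

end Stress

section Antidivergence

variable {d : ℕ}

lemma IsAdmissible.smoothPeriodic {v : (Fin d → ℝ) → Fin d → ℝ} (hv : IsAdmissible v) (k : Fin d) :
    SmoothPeriodic fun y => v y k :=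
  ⟨contDiff_pi.1 hv.1 k, fun x i => congrFun (hv.2.1 x i) k⟩

/-- The antidivergence operator built from an inverse Laplacian. -/
noncomputable def antidiv (L : ((Fin d → ℝ) → ℝ) → (Fin d → ℝ) → ℝ)
    (v : (Fin d → ℝ) → Fin d → ℝ) (x : Fin d → ℝ) : Matrix (Fin d) (Fin d) ℝ :=
  Matrix.of fun i j => stress (fun k => L (L fun y => v y k)) i j x

lemma memLp_box {g : (Fin d → ℝ) → ℝ} (hg : Continuous g) (p : ENNReal) :
    MemLp g p (volume.restrict (box d)) := by
  have : IsFiniteMeasure (volume.restrict (box d)) := ⟨by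
    simpa using volume_box_ne_top.lt_top⟩
  obtain ⟨C, hC⟩ := isCompact_Icc.exists_bound_of_continuousOn hg.continuousOn
  exact MemLp.of_bound hg.aestronglyMeasurable C
    ((ae_restrict_iff' measurableSet_Icc).2 (ae_of_all _ hC))

lemma integral_rpow_eq_toReal_eLpNorm {g : (Fin d → ℝ) → ℝ} (hg : Continuous g)
    (h0 : ∀ x, 0 ≤ g x) {p : ℝ} (hp : 1 ≤ p) :
    (∫ x in box d, g x ^ p) ^ (1 / p) =
      (eLpNorm g (ENNReal.ofReal p) (volume.restrict (box d))).toReal := by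
  have hp0 : 0 < p := by linarith
  rw [MemLp.eLpNorm_eq_integral_rpow_norm (by simpa using hp0) ENNReal.ofReal_ne_top
    (memLp_box hg _), ENNReal.toReal_ofReal hp0.le, ENNReal.toReal_ofReal (by positivity), one_div]
  simp only [Real.norm_of_nonneg (h0 _)]

namespace IsInverseLaplacian

variable {L : ((Fin d → ℝ) → ℝ) → (Fin d → ℝ) → ℝ}

lemma smoothPeriodic_sq (hL : IsInverseLaplacian L) {v : (Fin d → ℝ) → Fin d → ℝ}
    (hv : IsAdmissible v) (k : Fin d) : SmoothPeriodic (L (L fun y => v y k)) :=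
  hL.smoothPeriodic (hL.smoothPeriodic (hv.smoothPeriodic k))

lemma antidiv_add (hL : IsInverseLaplacian L) {v w : (Fin d → ℝ) → Fin d → ℝ}
    (hv : IsAdmissible v) (hw : IsAdmissible w) : antidiv L (v + w) = antidiv L v + antidiv L w := by
  have h : ∀ k, L (L fun y => v y k + w y k) =
      fun x => L (L fun y => v y k) x + L (L fun y => w y k) x := fun k => by
    rw [← hL.add (hL.smoothPeriodic (hv.smoothPeriodic k)) (hL.smoothPeriodic (hw.smoothPeriodic k)),
      ← hL.add (hv.smoothPeriodic k) (hw.smoothPeriodic k)]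
  funext x
  ext i j
  simp only [antidiv, h, Pi.add_apply, Matrix.add_apply, Matrix.of_apply,
    stress_add (hL.smoothPeriodic_sq hv) (hL.smoothPeriodic_sq hw)]

lemma antidiv_smul (hL : IsInverseLaplacian L) {v : (Fin d → ℝ) → Fin d → ℝ}
    (hv : IsAdmissible v) (c : ℝ) : antidiv L (c • v) = c • antidiv L v := by
  have h : ∀ k, L (L fun y => (c • v) y k) = fun x => c * L (L fun y => v y k) x := fun k => by
    rw [← hL.const_mul (hL.smoothPeriodic (hv.smoothPeriodic k)),
      ← hL.const_mul (hv.smoothPeriodic k)]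
    rfl
  funext x
  ext i j
  simp only [antidiv, h, Pi.smul_apply c (antidiv L v), Matrix.smul_apply, Matrix.of_apply,
    stress_const_mul (hL.smoothPeriodic_sq hv), smul_eq_mul]

lemma sum_partialDeriv_antidiv (hL : IsInverseLaplacian L) (hd : 2 ≤ d)
    {v : (Fin d → ℝ) → Fin d → ℝ} (hv : IsAdmissible v) (x : Fin d → ℝ) (i : Fin d) :
    ∑ j, partialDeriv j (fun y => antidiv L v y i j) x = v x i := by
  have hi := hv.smoothPeriodic i
  refine (sum_partialDeriv_stress hd (hL.smoothPeriodic_sq hv) i x).trans ?_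
  rw [← hL.map_lap (hL.smoothPeriodic hi), hL.lap_eq hi (hv.2.2 i), hL.lap_eq hi (hv.2.2 i)]

lemma antidiv_lap (hL : IsInverseLaplacian L) {v : (Fin d → ℝ) → Fin d → ℝ} (hv : IsAdmissible v)
    (hdiv : ∀ x, ∑ i, partialDeriv i (fun y => v y i) x = 0) (x : Fin d → ℝ) (i j : Fin d) :
    antidiv L (fun y k => lap (fun w => v w k) y) x i j =
      partialDeriv j (fun y => v y i) x + partialDeriv i (fun y => v y j) x := by
  have hs := hv.smoothPeriodic
  have hinv : ∀ k, L (L (lap fun w => v w k)) = L fun w => v w k := fun k => by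
    rw [hL.map_lap (hs k), hL.lap_eq (hs k) (hv.2.2 k)]
  have hlap : ∀ k, lap (L fun w => v w k) = fun w => v w k := fun k =>
    hL.lap_eq (hs k) (hv.2.2 k)
  have h1 : SmoothPeriodic fun y => ∑ k, partialDeriv k (L fun w => v w k) y :=
    .sum _ fun k _ => (hL.smoothPeriodic (hs k)).partialDeriv k
  have h2 : (fun y => ∑ k, partialDeriv k (L fun w => v w k) y) = fun _ => 0 := by
    simp only [hL.comm_partialDeriv (hs _)]
    rw [← hL.map_sum _ fun k => (hs k).partialDeriv k]
    simp only [hdiv, hL.map_zero]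
  have h3 : ∑ k, partialDeriv i (partialDeriv j (partialDeriv k (L fun w => v w k))) x = 0 := by
    have hk := fun k => (hL.smoothPeriodic (hs k)).partialDeriv k
    have h4 := partialDeriv_sum Finset.univ (fun k _ => (hk k).partialDeriv j) i
    rw [← partialDeriv_sum Finset.univ (fun k _ => hk k) j, h2, partialDeriv_const,
      partialDeriv_const] at h4
    exact (congrFun h4 x).symm
  change stress (fun k => L (L (lap fun w => v w k))) i j x = _
  simp only [stress, hinv, hlap, h3, hdiv]
  ring

lemma exists_bound_antidiv (hL : IsInverseLaplacian L) {p : ℝ} (hp : 1 ≤ p) :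
    ∃ C : ℝ, ∀ v, IsAdmissible v →
      (∫ x in box d, frobNorm (antidiv L v x) ^ p) ^ (1 / p) ≤
        C * (∫ x in box d, Real.sqrt (∑ i, (v x i) ^ 2) ^ p) ^ (1 / p) := by
  obtain ⟨C, hC, hb⟩ := hL.exists_bound_partialDeriv_three
  set K : ℝ := d + d + |((d : ℝ) - 1)⁻¹| * (d * d) + |(2 - d : ℝ) / (d - 1)| * d
  let N : ENNReal := ‖(d * (d * K) : ℝ)‖ₑ * ((Fintype.card (Fin d × Fin d × Fin d × Fin d) : ENNReal) * C)
  have hN : N ≠ ⊤ := ENNReal.mul_ne_top enorm_ne_top 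
    (ENNReal.mul_ne_top (ENNReal.natCast_ne_top _) hC)
  refine ⟨N.toReal, fun v hv => ?_⟩
  set u : Fin d → (Fin d → ℝ) → ℝ := fun k => L (L fun y => v y k) with hu
  have hus : ∀ k, SmoothPeriodic (u k) := hL.smoothPeriodic_sq hv
  have hvc : Continuous fun x => Real.sqrt (∑ i, (v x i) ^ 2) := by
    have := fun i => (hv.smoothPeriodic i).continuous
    fun_prop
  have hRc : Continuous fun x => frobNorm (antidiv L v x) := by
    have : ∀ i j, Continuous fun x => antidiv L v x i j := fun i j =>
      (SmoothPeriodic.stress hus i j).continuous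
    unfold frobNorm
    fun_prop
  rw [integral_rpow_eq_toReal_eLpNorm hRc (fun _ => Real.sqrt_nonneg _) hp,
    integral_rpow_eq_toReal_eLpNorm hvc (fun _ => Real.sqrt_nonneg _) hp, ← ENNReal.toReal_mul]
  refine ENNReal.toReal_mono (ENNReal.mul_ne_top hN (memLp_box hvc _).eLpNorm_ne_top) ?_
  have hq : ∀ q : Fin d × Fin d × Fin d × Fin d, SmoothPeriodic
      (partialDeriv q.1 (partialDeriv q.2.1 (partialDeriv q.2.2.1 (u q.2.2.2)))) := fun q =>
    (((hus _).partialDeriv _).partialDeriv _).partialDeriv _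
  have hfrob : ∀ x, ‖frobNorm (antidiv L v x)‖ ≤ (((d * (d * K) : ℝ)) • thirdDerivSum u) x :=
    fun x => by
    rw [Real.norm_of_nonneg (r := frobNorm _) (Real.sqrt_nonneg _), Pi.smul_apply, smul_eq_mul]
    refine (frobNorm_le_sum _).trans ((Finset.sum_le_sum fun i _ => Finset.sum_le_sum fun j _ =>
      abs_stress_le hus i j x).trans_eq ?_)
    simp only [Finset.sum_const, Finset.card_univ, Fintype.card_fin, nsmul_eq_mul]
    ring
  have hsum : thirdDerivSum u = ∑ q : Fin d × Fin d × Fin d × Fin d, fun x =>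
      ‖partialDeriv q.1 (partialDeriv q.2.1 (partialDeriv q.2.2.1 (u q.2.2.2))) x‖ := by
    funext x
    simp [thirdDerivSum]
  have hcomp : ∀ k, eLpNorm (fun y => v y k) (ENNReal.ofReal p) (volume.restrict (box d)) ≤
      eLpNorm (fun x => Real.sqrt (∑ i, (v x i) ^ 2)) (ENNReal.ofReal p)
        (volume.restrict (box d)) := fun k => eLpNorm_mono_real fun x => by
    rw [Real.norm_eq_abs]
    exact Real.abs_le_sqrt (Finset.single_le_sum (f := fun i => v x i ^ 2)
      (fun _ _ => sq_nonneg _) (Finset.mem_univ k))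
  refine (eLpNorm_mono_real hfrob).trans ?_
  rw [eLpNorm_const_smul, mul_assoc, hsum]
  refine mul_le_mul_right ((eLpNorm_sum_le
    (fun q _ => (hq q).continuous.norm.aestronglyMeasurable) (by simpa using hp)).trans ?_) _
  refine (Finset.sum_le_card_nsmul _ _ (C * eLpNorm (fun x => Real.sqrt (∑ i, (v x i) ^ 2))
    (ENNReal.ofReal p) (volume.restrict (box d))) fun q _ => ?_).trans_eq ?_
  · rw [eLpNorm_norm]
    exact (hb p hp _ _ _ _ (hv.smoothPeriodic _)).trans (mul_le_mul_right (hcomp _) C)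
  · rw [nsmul_eq_mul, Finset.card_univ, mul_assoc]

end IsInverseLaplacian

end Antidivergence

/-- The antidivergence operator `𝓡`: a linear right inverse of the divergence on
smooth periodic mean-zero vector fields, taking values in smooth periodic symmetric
trace-free matrix fields, bounded on `L^p` for every `p ∈ [1, ∞)`, and satisfying
`𝓡(Δv) = ∇v + (∇v)ᵀ` for divergence-free `v`. -/
theorem antidivergence_operator (d : ℕ) (hd : 2 ≤ d) :
    ∃ R : ((Fin d → ℝ) → Fin d → ℝ) → ((Fin d → ℝ) → Matrix (Fin d) (Fin d) ℝ),
      -- linearity on admissible fields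
      (∀ v w, IsAdmissible v → IsAdmissible w → R (v + w) = R v + R w) ∧
      (∀ v (c : ℝ), IsAdmissible v → R (c • v) = c • R v) ∧
      -- smoothness, periodicity, (i) symmetric trace-free values, (ii) div (R v) = v
      (∀ v, IsAdmissible v →
        (∀ i j, ContDiff ℝ (⊤ : ℕ∞) (fun x => R v x i j)) ∧
        (∀ (x : Fin d → ℝ) (k : Fin d) (i j : Fin d),
          R v (x + Pi.single k (2 * π)) i j = R v x i j) ∧
        (∀ x, (R v x).IsSymm ∧ (R v x).trace = 0) ∧
        (∀ (x : Fin d → ℝ) (i : Fin d),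
          ∑ j, fderiv ℝ (fun y => R v y i j) x (Pi.single j 1) = v x i)) ∧
      -- (iii) L^p bounds
      (∀ p : ℝ, 1 ≤ p → ∃ C : ℝ, ∀ v, IsAdmissible v →
        (∫ x in box d, frobNorm (R v x) ^ p) ^ (1 / p)
          ≤ C * (∫ x in box d, Real.sqrt (∑ i, (v x i) ^ 2) ^ p) ^ (1 / p)) ∧
      -- (iv) R (Δ v) = ∇v + (∇v)ᵀ for divergence-free admissible v
      (∀ v, IsAdmissible v →
        (∀ x : Fin d → ℝ, ∑ i, fderiv ℝ (fun y => v y i) x (Pi.single i 1) = 0) →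
        ∀ (x : Fin d → ℝ) (i j : Fin d),
          R (fun y k => ∑ l,
              fderiv ℝ (fun z => fderiv ℝ (fun w => v w k) z (Pi.single l 1)) y
                (Pi.single l 1)) x i j
            = fderiv ℝ (fun y => v y i) x (Pi.single j 1)
              + fderiv ℝ (fun y => v y j) x (Pi.single i 1)) := by
  obtain ⟨L, hL⟩ := exists_isInverseLaplacian d
  refine ⟨antidiv L, fun v w hv hw => hL.antidiv_add hv hw, fun v c hv => hL.antidiv_smul hv c,
    fun v hv => ?_, fun p hp => hL.exists_bound_antidiv hp,
    fun v hv hdiv x i j => hL.antidiv_lap hv hdiv x i j⟩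
  have hu := hL.smoothPeriodic_sq hv
  refine ⟨fun i j => (SmoothPeriodic.stress hu i j).1,
    fun x k i j => (SmoothPeriodic.stress hu i j).2 x k,
    fun x => ⟨Matrix.IsSymm.ext fun i j => stress_comm hu j i x, sum_stress_self hd hu x⟩,
    hL.sum_partialDeriv_antidiv hd hv⟩
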